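/- arXiv:1011.3029 — 7 statements merged into one kernel-verified Lean document; each statement's English description precedes it below -/
import Mathlib

section
/- Let F : ℝ^k → ℝ be differentiable and concave with F(0) ≥ 0 and with all partial derivatives ∂ᵢF nonnegative everywhere. Fix x ∈ ℝ^k, a future-timelike vector X ∈ ℝ^{m+1}, and past-causal vectors Y₁, …, Y_k ∈ ℝ^{m+1}. Then the vector Σ_{i=1}^{k} ∂ᵢF(x)·Yᵢ − (1/2)·(F(x) − Σ_{i=1}^{k} ∂ᵢF(x)·xᵢ)·X is past-causal. (This is the pointwise content of the paper's Lemma 1: if each stress-energy tensor Tᵢ obeys the dominant energy condition, then so does the stress-energy tensor of the Lagrangian L = F(L₁,…,L_k).) -/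
open Finset

/-- The Minkowski bilinear form on `ℝ^{m+1}`: `η(x,y) = -x₀y₀ + Σ_{i≥1} xᵢyᵢ`. -/
noncomputable def mink (m : ℕ) (x y : Fin (m + 1) → ℝ) : ℝ :=
  ∑ i, (if i = 0 then (-1 : ℝ) else 1) * x i * y i

/-- A vector is past-causal if `η(x,x) ≤ 0` and `x₀ ≤ 0`. -/
def PastCausal (m : ℕ) (x : Fin (m + 1) → ℝ) : Prop :=
  mink m x x ≤ 0 ∧ x 0 ≤ 0

/-- A vector is future-timelike if `η(x,x) < 0` and `x₀ > 0`. -/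
def FutureTimelike (m : ℕ) (x : Fin (m + 1) → ℝ) : Prop :=
  mink m x x < 0 ∧ x 0 > 0

theorem mink_eq_neg_add_sum_succ (m : ℕ) (x y : Fin (m + 1) → ℝ) :
    mink m x y = -(x 0 * y 0) + ∑ i : Fin m, x i.succ * y i.succ := by
  simp [mink, Fin.sum_univ_succ]

theorem mink_add_self (m : ℕ) (x y : Fin (m + 1) → ℝ) :
    mink m (x + y) (x + y) = mink m x x + 2 * mink m x y + mink m y y := by
  simp only [mink, Finset.mul_sum, ← Finset.sum_add_distrib, Pi.add_apply]
  exact Finset.sum_congr rfl fun i _ => by ring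

theorem mink_smul_self (m : ℕ) (c : ℝ) (x : Fin (m + 1) → ℝ) :
    mink m (c • x) (c • x) = c ^ 2 * mink m x x := by
  simp only [mink, Finset.mul_sum, Pi.smul_apply, smul_eq_mul]
  exact Finset.sum_congr rfl fun i _ => by ring

namespace PastCausal

variable {m : ℕ} {x y : Fin (m + 1) → ℝ}

/-- The reversed Cauchy–Schwarz sign: two past-causal vectors have nonpositive product. -/
theorem mink_nonpos (hx : PastCausal m x) (hy : PastCausal m y) : mink m x y ≤ 0 := by
  obtain ⟨hx, hx0⟩ := hx
  obtain ⟨hy, hy0⟩ := hy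
  rw [mink_eq_neg_add_sum_succ] at *
  have hxy : 0 ≤ x 0 * y 0 := mul_nonneg_of_nonpos_of_nonpos hx0 hy0
  have hcs := Finset.sum_mul_sq_le_sq_mul_sq univ (fun i : Fin m => x i.succ) fun i => y i.succ
  simp only [← pow_two] at hx hy
  have hprod : (∑ i : Fin m, x i.succ ^ 2) * ∑ i : Fin m, y i.succ ^ 2 ≤ x 0 ^ 2 * y 0 ^ 2 :=
    mul_le_mul (by linarith) (by linarith) (Finset.sum_nonneg fun i _ => sq_nonneg _)
      (sq_nonneg _)
  have hle := abs_le_of_sq_le_sq (hcs.trans (hprod.trans_eq (mul_pow _ _ 2).symm)) hxy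
  linarith [le_abs_self (∑ i : Fin m, x i.succ * y i.succ)]

theorem zero : PastCausal m 0 := by simp [PastCausal, mink]

theorem add (hx : PastCausal m x) (hy : PastCausal m y) : PastCausal m (x + y) := by
  refine ⟨?_, add_nonpos hx.2 hy.2⟩
  rw [mink_add_self]
  linarith [hx.1, hy.1, hx.mink_nonpos hy]

theorem smul {c : ℝ} (hc : 0 ≤ c) (hx : PastCausal m x) : PastCausal m (c • x) := by
  refine ⟨?_, mul_nonpos_of_nonneg_of_nonpos hc hx.2⟩
  rw [mink_smul_self]
  exact mul_nonpos_of_nonneg_of_nonpos (sq_nonneg c) hx.1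

theorem sum {ι : Type*} (s : Finset ι) {Y : ι → Fin (m + 1) → ℝ}
    (hY : ∀ i ∈ s, PastCausal m (Y i)) : PastCausal m (∑ i ∈ s, Y i) :=
  Finset.sum_induction Y (PastCausal m) (fun _ _ => add) zero hY

end PastCausal

theorem FutureTimelike.pastCausal_neg {m : ℕ} {x : Fin (m + 1) → ℝ} (hx : FutureTimelike m x) :
    PastCausal m (-x) := by
  refine ⟨?_, neg_nonpos.2 hx.2.le⟩
  simpa [mink] using hx.1.le

/-- A concave function lies below its tangent hyperplanes, evaluated at the origin. -/
theorem ConcaveOn.apply_zero_le_sub_fderiv {E : Type*} [NormedAddCommGroup E] [NormedSpace ℝ E]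
    {F : E → ℝ} (hF : ConcaveOn ℝ Set.univ F) {x : E} (hd : DifferentiableAt ℝ F x) :
    F 0 ≤ F x - fderiv ℝ F x x := by
  have hconc : ConcaveOn ℝ Set.univ fun t : ℝ => F (t • x) :=
    hF.comp_linearMap (LinearMap.toSpanSingleton ℝ E x)
  have hline : HasDerivAt (fun t : ℝ => t • x) x 1 := by
    simpa using (hasDerivAt_id (1 : ℝ)).smul_const x
  have hder : HasDerivAt (fun t : ℝ => F (t • x)) (fderiv ℝ F x x) 1 :=
    HasFDerivAt.comp_hasDerivAt_of_eq 1 hd.hasFDerivAt hline (one_smul ℝ x).symm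
  have hslope := hconc.le_slope_of_hasDerivAt (Set.mem_univ 0) (Set.mem_univ 1) one_pos hder
  simp only [slope_def_field, one_smul, zero_smul, sub_zero, div_one] at hslope
  linarith

/-- Pointwise content of Lemma 1: if `F : ℝ^k → ℝ` is differentiable, concave, `F(0) ≥ 0`,
with nonnegative partial derivatives, `X` is future-timelike and the `Yᵢ` are past-causal,
then `Σᵢ ∂ᵢF(x)·Yᵢ − ½(F(x) − Σᵢ ∂ᵢF(x)·xᵢ)·X` is past-causal. -/
theorem stmt0 (k m : ℕ) (F : (Fin k → ℝ) → ℝ)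
    (hdiff : Differentiable ℝ F)
    (hconc : ConcaveOn ℝ Set.univ F)
    (h0 : 0 ≤ F 0)
    (hpos : ∀ (x : Fin k → ℝ) (i : Fin k), 0 ≤ fderiv ℝ F x (Pi.single i 1))
    (x : Fin k → ℝ)
    (X : Fin (m + 1) → ℝ) (hX : FutureTimelike m X)
    (Y : Fin k → (Fin (m + 1) → ℝ)) (hY : ∀ i, PastCausal m (Y i)) :
    PastCausal m
      ((∑ i, fderiv ℝ F x (Pi.single i 1) • Y i)
        - ((1 / 2) * (F x - ∑ i, fderiv ℝ F x (Pi.single i 1) * x i)) • X) := by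
  have hsum : ∑ i, fderiv ℝ F x (Pi.single i 1) * x i = fderiv ℝ F x x := by
    conv_rhs => arg 2; rw [← Finset.univ_sum_single x]
    rw [map_sum]
    refine Finset.sum_congr rfl fun i _ => ?_
    have hsingle : Pi.single i (x i) = x i • (Pi.single i 1 : Fin k → ℝ) := by
      simp [← Pi.single_smul]
    rw [hsingle, map_smul, smul_eq_mul, mul_comm]
  have htangent := hconc.apply_zero_le_sub_fderiv (hdiff x)
  rw [hsum, sub_eq_add_neg, ← smul_neg]
  exact (PastCausal.sum univ fun i _ => (hY i).smul (hpos x i)).add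
    (hX.pastCausal_neg.smul (by linarith))
end

section
/- For every linear map A : ℝ⁴ → E and every timelike covector ξ (i.e. η*(ξ,ξ) < 0), the Skyrme principal symbol m_A(ξ) is negative definite; in fact m_A(ξ)(Y,Y) ≤ η*(ξ,ξ)·‖Y‖² for all Y ∈ E. (This is the paper's assertion, via Theorem 2(i), that every time function of the underlying Minkowski metric is an admissible time function for the Skyrme model.) -/
open RealInnerProductSpace

/-- The Minkowski signs `ε₀ = -1`, `ε₁ = ε₂ = ε₃ = 1` on `ℝ⁴`. -/
noncomputable def eps : Fin 4 → ℝ := fun a => if a = 0 then -1 else 1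

/-- `η*(ξ,ξ) = −ξ₀² + ξ₁² + ξ₂² + ξ₃²`, the Minkowski form on covectors. -/
noncomputable def etaStar (ξ : Fin 4 → ℝ) : ℝ := ∑ a, eps a * ξ a * ξ a

/-- The η-raising of a covector: `ξ♯ = (−ξ₀, ξ₁, ξ₂, ξ₃)`. -/
noncomputable def sharp (ξ : Fin 4 → ℝ) : Fin 4 → ℝ := fun a => eps a * ξ a

/-- The principal symbol of the Skyrme equations of motion (for `L = σ₁ + σ₂`, at a point
where `dφ = A`): `m_A(ξ)(Y,Z) = η*(ξ,ξ)[(1 + Σ_a ε_a‖Ae_a‖²)⟨Y,Z⟩ −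
Σ_a ε_a⟨Ae_a,Y⟩⟨Ae_a,Z⟩] + ⟨A(ξ♯),Y⟩⟨A(ξ♯),Z⟩ − ‖A(ξ♯)‖²⟨Y,Z⟩`. -/
noncomputable def skyrmeSymbol {E : Type*} [NormedAddCommGroup E] [InnerProductSpace ℝ E]
    (A : (Fin 4 → ℝ) →ₗ[ℝ] E) (ξ : Fin 4 → ℝ) (Y Z : E) : ℝ :=
  etaStar ξ * ((1 + ∑ a, eps a * ‖A (Pi.single a 1)‖ ^ 2) * ⟪Y, Z⟫
      - ∑ a, eps a * (⟪A (Pi.single a 1), Y⟫ * ⟪A (Pi.single a 1), Z⟫))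
    + ⟪A (sharp ξ), Y⟫ * ⟪A (sharp ξ), Z⟫ - ‖A (sharp ξ)‖ ^ 2 * ⟪Y, Z⟫

/-- A positive semidefinite form `B` on `ℝ⁴` satisfies
`η*(ξ,ξ) · Σ_a ε_a B(e_a, e_a) ≤ B(ξ♯, ξ♯)` for every timelike covector `ξ`. -/
theorem etaStar_mul_trace_le (B : LinearMap.BilinForm ℝ (Fin 4 → ℝ))
    (hsymm : ∀ x y, B x y = B y x) (hpos : ∀ x, 0 ≤ B x x)
    (ξ : Fin 4 → ℝ) (hξ : etaStar ξ < 0) :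
    etaStar ξ * ∑ a, eps a * B (Pi.single a 1) (Pi.single a 1) ≤ B (sharp ξ) (sharp ξ) := by
  have hsharp : sharp ξ = -ξ 0 • Pi.single 0 1 + ξ 1 • Pi.single 1 1 + ξ 2 • Pi.single 2 1
      + ξ 3 • Pi.single 3 1 := by
    ext a
    fin_cases a <;> simp [sharp, eps]
  have heta : etaStar ξ = -(ξ 0) ^ 2 + (ξ 1) ^ 2 + (ξ 2) ^ 2 + (ξ 3) ^ 2 := by
    simp [etaStar, eps, Fin.sum_univ_four]
    ring
  rw [hsharp, Fin.sum_univ_four]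
  simp only [eps, if_true, Fin.isValue, one_ne_zero, if_false, Fin.reduceEq]
  rw [heta] at hξ ⊢
  generalize (Pi.single 0 1 : Fin 4 → ℝ) = e₀, (Pi.single 1 1 : Fin 4 → ℝ) = e₁,
    (Pi.single 2 1 : Fin 4 → ℝ) = e₂, (Pi.single 3 1 : Fin 4 → ℝ) = e₃
  generalize ξ 0 = t, ξ 1 = x, ξ 2 = y, ξ 3 = z at hξ ⊢
  rcases (by positivity : 0 ≤ x ^ 2 + y ^ 2 + z ^ 2).eq_or_lt with hr | hr
  · obtain rfl : x = 0 := by nlinarith [sq_nonneg x, sq_nonneg y, sq_nonneg z]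
    obtain rfl : y = 0 := by nlinarith [sq_nonneg y, sq_nonneg z]
    obtain rfl : z = 0 := by nlinarith [sq_nonneg z]
    simp only [map_add, map_smul, LinearMap.add_apply, LinearMap.smul_apply, smul_eq_mul]
    nlinarith [mul_nonneg (sq_nonneg t) (hpos e₁), mul_nonneg (sq_nonneg t) (hpos e₂),
      mul_nonneg (sq_nonneg t) (hpos e₃)]
  · have hboost := hpos ((x ^ 2 + y ^ 2 + z ^ 2) • e₀ + (-(t * x)) • e₁ + (-(t * y)) • e₂
      + (-(t * z)) • e₃)
    have hτ : 0 ≤ t ^ 2 - x ^ 2 - y ^ 2 - z ^ 2 := by linarith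
    have hyz := mul_nonneg hτ (hpos (z • e₂ + (-y) • e₃))
    have hzx := mul_nonneg hτ (hpos (x • e₃ + (-z) • e₁))
    have hxy := mul_nonneg hτ (hpos (y • e₁ + (-x) • e₂))
    refine le_of_mul_le_mul_left ?_ hr
    simp only [map_add, map_smul, LinearMap.add_apply, LinearMap.smul_apply, smul_eq_mul,
      hsymm e₁ e₀, hsymm e₂ e₀, hsymm e₃ e₀, hsymm e₂ e₁, hsymm e₃ e₁, hsymm e₃ e₂]
      at hboost hyz hzx hxy ⊢
    linear_combination hboost + hyz + hzx + hxy

/-- For every linear map `A : ℝ⁴ → E` and every timelike covector `ξ`, the Skyrme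
principal symbol `m_A(ξ)` is negative definite; indeed
`m_A(ξ)(Y,Y) ≤ η*(ξ,ξ)·‖Y‖²` for all `Y`. -/
theorem stmt8 {E : Type*} [NormedAddCommGroup E] [InnerProductSpace ℝ E]
    (A : (Fin 4 → ℝ) →ₗ[ℝ] E) (ξ : Fin 4 → ℝ) (hξ : etaStar ξ < 0) :
    (∀ Y : E, skyrmeSymbol A ξ Y Y ≤ etaStar ξ * ‖Y‖ ^ 2) ∧
    (∀ Y : E, Y ≠ 0 → skyrmeSymbol A ξ Y Y < 0) := by
  have hle : ∀ Y : E, skyrmeSymbol A ξ Y Y ≤ etaStar ξ * ‖Y‖ ^ 2 := by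
    intro Y
    let G : LinearMap.BilinForm ℝ E :=
      ‖Y‖ ^ 2 • innerₗ E - LinearMap.BilinForm.linMulLin (innerₗ E Y) (innerₗ E Y)
    have hG : ∀ u v, G u v = ‖Y‖ ^ 2 * ⟪u, v⟫ - ⟪u, Y⟫ * ⟪v, Y⟫ := fun u v => by
      simp [G, real_inner_comm]
    have h := etaStar_mul_trace_le (G.comp A A)
      (fun x y => by
        simp only [LinearMap.BilinForm.comp_apply, hG, real_inner_comm (A x) (A y)]
        ring)
      (fun x => by
        simp only [LinearMap.BilinForm.comp_apply, hG]
        have := real_inner_mul_inner_self_le (A x) Y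
        rw [real_inner_self_eq_norm_sq Y] at this
        linarith) ξ hξ
    simp only [LinearMap.BilinForm.comp_apply, hG, Fin.sum_univ_four,
      real_inner_self_eq_norm_sq] at h
    simp only [skyrmeSymbol, Fin.sum_univ_four, real_inner_self_eq_norm_sq]
    linear_combination h
  refine ⟨hle, fun Y hY => (hle Y).trans_lt (mul_neg_of_neg_of_pos hξ ?_)⟩
  positivity
end

section
/- Let A : ℝ⁴ → E be a linear map such that the standard basis is adapted to A (the vectors Ae₀, Ae₁, Ae₂, Ae₃ are pairwise orthogonal in E), and suppose λ₀ = ‖Ae₀‖ < 1. Then for every nonzero covector ξ with ξ(e₀) = 0, the Skyrme principal symbol m_A(ξ) is positive definite on E; in fact m_A(ξ)(Y,Y) ≥ η*(ξ,ξ)·(1 − λ₀²)·‖Y‖² for all Y. (This is the regular-hyperbolicity part of the paper's Theorem 4: e₀ is an observer field for the Skyrme model whenever the timelike eigenvector of the strain D^φ has eigenvalue of norm less than 1; it includes the case where the kernel of dφ contains a timelike vector, λ₀ = 0.) -/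
open RealInnerProductSpace

/-- Cauchy–Schwarz against a combination `s • v - t • u` of two orthogonal vectors. -/
theorem sq_inner_comb_le_of_inner_eq_zero {E : Type*} [NormedAddCommGroup E]
    [InnerProductSpace ℝ E] {u v : E} (h : ⟪u, v⟫ = 0) (s t : ℝ) (Y : E) :
    (s * ⟪v, Y⟫ - t * ⟪u, Y⟫) ^ 2 ≤ (s ^ 2 * ‖v‖ ^ 2 + t ^ 2 * ‖u‖ ^ 2) * ‖Y‖ ^ 2 := by
  have hvu : ⟪v, u⟫ = 0 := by rw [real_inner_comm, h]
  have hinner : ⟪s • v - t • u, Y⟫ = s * ⟪v, Y⟫ - t * ⟪u, Y⟫ := by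
    simp only [inner_sub_left, real_inner_smul_left]
  have hnorm : ‖s • v - t • u‖ ^ 2 = s ^ 2 * ‖v‖ ^ 2 + t ^ 2 * ‖u‖ ^ 2 := by
    simp only [← real_inner_self_eq_norm_sq, inner_sub_left, inner_sub_right,
      real_inner_smul_left, real_inner_smul_right, h, hvu]
    ring
  rw [← hinner, ← hnorm, ← mul_pow, sq_le_sq, abs_of_nonneg (by positivity : 0 ≤ ‖_‖ * ‖Y‖)]
  exact abs_real_inner_le_norm _ _

/-- The raising of a covector that annihilates `e₀` is its purely spatial combination. -/
theorem map_sharp_of_apply_zero_eq_zero {E : Type*} [AddCommGroup E] [Module ℝ E]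
    (A : (Fin 4 → ℝ) →ₗ[ℝ] E) {ξ : Fin 4 → ℝ} (hξ0 : ξ 0 = 0) :
    A (sharp ξ) = ξ 1 • A (Pi.single 1 1) + ξ 2 • A (Pi.single 2 1)
      + ξ 3 • A (Pi.single 3 1) := by
  simp only [← map_smul, ← map_add]
  congr 1
  ext a
  fin_cases a <;> simp [sharp, eps, hξ0]

theorem etaStar_of_apply_zero_eq_zero {ξ : Fin 4 → ℝ} (hξ0 : ξ 0 = 0) :
    etaStar ξ = ξ 1 ^ 2 + ξ 2 ^ 2 + ξ 3 ^ 2 := by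
  simp [etaStar, eps, Fin.sum_univ_four, hξ0]
  ring

theorem etaStar_pos_of_apply_zero_eq_zero {ξ : Fin 4 → ℝ} (hξ0 : ξ 0 = 0) (hξ : ξ ≠ 0) :
    0 < etaStar ξ := by
  rw [etaStar_of_apply_zero_eq_zero hξ0]
  by_contra! h
  apply hξ
  ext a
  fin_cases a
  · exact hξ0
  all_goals
    refine pow_eq_zero_iff two_ne_zero |>.mp ?_
    dsimp
    linarith [sq_nonneg (ξ 1), sq_nonneg (ξ 2), sq_nonneg (ξ 3)]

/-- Regular-hyperbolicity part of Theorem 4: if the standard basis is adapted to `A`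
(the `Ae_a` are pairwise orthogonal) and `λ₀ = ‖Ae₀‖ < 1`, then for every nonzero
covector `ξ` with `ξ(e₀) = 0` the Skyrme principal symbol `m_A(ξ)` is positive definite;
indeed `m_A(ξ)(Y,Y) ≥ η*(ξ,ξ)(1 − λ₀²)‖Y‖²` for all `Y`. -/
theorem stmt9 {E : Type*} [NormedAddCommGroup E] [InnerProductSpace ℝ E]
    (A : (Fin 4 → ℝ) →ₗ[ℝ] E)
    (hadapt : ∀ a b : Fin 4, a ≠ b → ⟪A (Pi.single a 1), A (Pi.single b 1)⟫ = 0)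
    (hlam0 : ‖A (Pi.single 0 1)‖ < 1)
    (ξ : Fin 4 → ℝ) (hξ0 : ξ 0 = 0) (hξ : ξ ≠ 0) :
    (∀ Y : E, etaStar ξ * (1 - ‖A (Pi.single 0 1)‖ ^ 2) * ‖Y‖ ^ 2 ≤ skyrmeSymbol A ξ Y Y) ∧
    (∀ Y : E, Y ≠ 0 → 0 < skyrmeSymbol A ξ Y Y) := by
  have hbound : ∀ Y : E,
      etaStar ξ * (1 - ‖A (Pi.single 0 1)‖ ^ 2) * ‖Y‖ ^ 2 ≤ skyrmeSymbol A ξ Y Y := by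
    intro Y
    have h12 := hadapt 1 2 (by decide)
    have h13 := hadapt 1 3 (by decide)
    have h23 := hadapt 2 3 (by decide)
    have c12 := sq_inner_comb_le_of_inner_eq_zero h12 (ξ 1) (ξ 2) Y
    have c13 := sq_inner_comb_le_of_inner_eq_zero h13 (ξ 1) (ξ 3) Y
    have c23 := sq_inner_comb_le_of_inner_eq_zero h23 (ξ 2) (ξ 3) Y
    have hnorm : ‖A (sharp ξ)‖ ^ 2 = ξ 1 ^ 2 * ‖A (Pi.single 1 1)‖ ^ 2
        + ξ 2 ^ 2 * ‖A (Pi.single 2 1)‖ ^ 2 + ξ 3 ^ 2 * ‖A (Pi.single 3 1)‖ ^ 2 := by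
      rw [map_sharp_of_apply_zero_eq_zero A hξ0]
      simp only [← real_inner_self_eq_norm_sq, inner_add_left, inner_add_right,
        real_inner_smul_left, real_inner_smul_right, h12, h13, h23,
        hadapt 2 1 (by decide), hadapt 3 1 (by decide), hadapt 3 2 (by decide)]
      ring
    have htime : 0 ≤ (ξ 1 ^ 2 + ξ 2 ^ 2 + ξ 3 ^ 2) * ⟪A (Pi.single 0 1), Y⟫ ^ 2 := by
      positivity
    rw [skyrmeSymbol, hnorm, map_sharp_of_apply_zero_eq_zero A hξ0,
      etaStar_of_apply_zero_eq_zero hξ0]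
    simp only [Fin.sum_univ_four, inner_add_left, real_inner_smul_left,
      real_inner_self_eq_norm_sq, eps, if_true, Fin.reduceEq, if_false]
    linarith
  refine ⟨hbound, fun Y hY => lt_of_lt_of_le ?_ (hbound Y)⟩
  have hη := etaStar_pos_of_apply_zero_eq_zero hξ0 hξ
  have hlam : 0 < 1 - ‖A (Pi.single 0 1)‖ ^ 2 :=
    sub_pos.mpr (pow_lt_one₀ (norm_nonneg _) hlam0 two_ne_zero)
  have hYpos : 0 < ‖Y‖ := norm_pos_iff.mpr hY
  positivity
end

section
/- Let E be a 3-dimensional real inner product space and A : ℝ⁴ → E a linear map such that the standard basis is adapted to A, with Ae₁ = 0 and λ₀ = ‖Ae₀‖ > 1. Then for every covector ξ = s·f₃ + r·f₀ with (s,r) ≠ (0,0) (f_a the dual basis), there is a unit vector Y ∈ E orthogonal to Ae₀ and Ae₃ (and parallel to Ae₂ when Ae₂ ≠ 0) with m_A(ξ)(Y,Y) = s²(1 − λ₀²) − r²(1 + λ₃²) < 0. Consequently, for every η-timelike vector X ∈ ℝ⁴ there exists a nonzero covector ξ with ξ(X) = 0 such that m_A(ξ) is not positive definite: no observer field exists,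 and the Skyrme model suffers an ultrahyperbolic breakdown of hyperbolicity. (Breakdown part of the paper's Theorem 4.) -/
open RealInnerProductSpace

/-- In dimension at least three, any two vectors have a common unit normal. -/
theorem exists_unit_orthogonal_pair {E : Type*} [NormedAddCommGroup E] [InnerProductSpace ℝ E]
    [FiniteDimensional ℝ E] (hdim : 3 ≤ Module.finrank ℝ E) (u v : E) :
    ∃ Y : E, ‖Y‖ = 1 ∧ ⟪u, Y⟫ = 0 ∧ ⟪v, Y⟫ = 0 := by
  classical
  set K : Submodule ℝ E := Submodule.span ℝ (({u, v} : Finset E) : Set E) with hK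
  have hle : Module.finrank ℝ K ≤ 2 :=
    (finrank_span_finset_le_card (R := ℝ) ({u, v} : Finset E)).trans Finset.card_le_two
  have hadd := K.finrank_add_finrank_orthogonal
  have hne : Kᗮ ≠ ⊥ := by
    intro h
    rw [h, finrank_bot] at hadd
    omega
  obtain ⟨y, hy, hy0⟩ := Submodule.exists_mem_ne_zero_of_ne_bot hne
  have hu : ⟪u, y⟫ = 0 := hy u (Submodule.subset_span (by simp))
  have hv : ⟪v, y⟫ = 0 := hy v (Submodule.subset_span (by simp))
  refine ⟨‖y‖⁻¹ • y, norm_smul_inv_norm (𝕜 := ℝ) hy0, ?_, ?_⟩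
  · rw [inner_smul_right, hu, mul_zero]
  · rw [inner_smul_right, hv, mul_zero]

/-- In dimension at least three, a vector `w` orthogonal to `u` and `v` has a unit direction
that is still orthogonal to `u` and `v`, even when `w = 0`. -/
theorem exists_unit_direction {E : Type*} [NormedAddCommGroup E] [InnerProductSpace ℝ E]
    [FiniteDimensional ℝ E] (hdim : 3 ≤ Module.finrank ℝ E) {u v w : E}
    (huw : ⟪u, w⟫ = 0) (hvw : ⟪v, w⟫ = 0) :
    ∃ Y : E, ‖Y‖ = 1 ∧ ⟪u, Y⟫ = 0 ∧ ⟪v, Y⟫ = 0 ∧ (w ≠ 0 → ∃ c : ℝ, Y = c • w) ∧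
      ⟪w, Y⟫ = ‖w‖ := by
  by_cases hw : w = 0
  · obtain ⟨Y, hY, hu, hv⟩ := exists_unit_orthogonal_pair hdim u v
    exact ⟨Y, hY, hu, hv, fun h => absurd hw h, by simp [hw]⟩
  · refine ⟨‖w‖⁻¹ • w, norm_smul_inv_norm (𝕜 := ℝ) hw, ?_, ?_, fun _ => ⟨_, rfl⟩, ?_⟩
    · rw [inner_smul_right, huw, mul_zero]
    · rw [inner_smul_right, hvw, mul_zero]
    · rw [inner_smul_right, real_inner_self_eq_norm_sq]
      have := norm_ne_zero_iff.mpr hw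
      field_simp

theorem skyrmeSymbol_eq_of_unit_direction {E : Type*} [NormedAddCommGroup E]
    [InnerProductSpace ℝ E] (A : (Fin 4 → ℝ) →ₗ[ℝ] E)
    (h30 : ⟪A (Pi.single 3 1), A (Pi.single 0 1)⟫ = 0) (h1 : A (Pi.single 1 1) = 0)
    {Y : E} (hY : ‖Y‖ = 1) (h0Y : ⟪A (Pi.single 0 1), Y⟫ = 0)
    (h3Y : ⟪A (Pi.single 3 1), Y⟫ = 0) (h2Y : ⟪A (Pi.single 2 1), Y⟫ = ‖A (Pi.single 2 1)‖)
    (s r : ℝ) :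
    skyrmeSymbol A (s • (Pi.single 3 1 : Fin 4 → ℝ) + r • (Pi.single 0 1 : Fin 4 → ℝ)) Y Y
      = s ^ 2 * (1 - ‖A (Pi.single 0 1)‖ ^ 2) - r ^ 2 * (1 + ‖A (Pi.single 3 1)‖ ^ 2) := by
  have hs : sharp (s • (Pi.single 3 1 : Fin 4 → ℝ) + r • (Pi.single 0 1 : Fin 4 → ℝ))
      = s • (Pi.single 3 1 : Fin 4 → ℝ) - r • (Pi.single 0 1 : Fin 4 → ℝ) := by
    ext a
    fin_cases a <;> simp [sharp, eps]
  have he : etaStar (s • (Pi.single 3 1 : Fin 4 → ℝ) + r • (Pi.single 0 1 : Fin 4 → ℝ))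
      = s ^ 2 - r ^ 2 := by
    simp [etaStar, eps, Fin.sum_univ_four]
    ring
  have hn : ‖s • A (Pi.single 3 1) - r • A (Pi.single 0 1)‖ ^ 2
      = s ^ 2 * ‖A (Pi.single 3 1)‖ ^ 2 + r ^ 2 * ‖A (Pi.single 0 1)‖ ^ 2 := by
    rw [norm_sub_sq_real, inner_smul_left, inner_smul_right, h30, norm_smul, norm_smul,
      mul_pow, mul_pow, Real.norm_eq_abs, Real.norm_eq_abs, sq_abs, sq_abs]
    ring
  have hYY : ⟪Y, Y⟫ = 1 := by rw [real_inner_self_eq_norm_sq, hY, one_pow]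
  rw [skyrmeSymbol, hs, he, map_sub, map_smul, map_smul, hn, inner_sub_left, inner_smul_left,
    inner_smul_left, h0Y, h3Y, hYY, Fin.sum_univ_four, Fin.sum_univ_four, h0Y, h3Y, h2Y, h1,
    inner_zero_left, norm_zero]
  simp only [eps, Fin.isValue, if_true, one_ne_zero, if_false,
    show (2 : Fin 4) ≠ 0 by decide, show (3 : Fin 4) ≠ 0 by decide]
  ring

/-- Breakdown part of Theorem 4: if `E` is 3-dimensional, the standard basis is adapted
to `A`, `Ae₁ = 0` and `λ₀ = ‖Ae₀‖ > 1`, then (i) for every covector `ξ = s·f₃ + r·f₀`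
with `(s,r) ≠ (0,0)` there is a unit vector `Y` orthogonal to `Ae₀` and `Ae₃` (parallel
to `Ae₂` when `Ae₂ ≠ 0`) with `m_A(ξ)(Y,Y) = s²(1 − λ₀²) − r²(1 + λ₃²) < 0`; hence
(ii) for every η-timelike `X` there is a nonzero covector `ξ` with `ξ(X) = 0` such that
`m_A(ξ)` is not positive definite: no observer field exists (ultrahyperbolic breakdown). -/
theorem stmt10 {E : Type*} [NormedAddCommGroup E] [InnerProductSpace ℝ E]
    [FiniteDimensional ℝ E] (hdim : Module.finrank ℝ E = 3)
    (A : (Fin 4 → ℝ) →ₗ[ℝ] E)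
    (hadapt : ∀ a b : Fin 4, a ≠ b → ⟪A (Pi.single a 1), A (Pi.single b 1)⟫ = 0)
    (h1 : A (Pi.single 1 1) = 0)
    (hlam0 : 1 < ‖A (Pi.single 0 1)‖) :
    (∀ s r : ℝ, (s, r) ≠ ((0 : ℝ), (0 : ℝ)) →
      ∃ Y : E, ‖Y‖ = 1 ∧ ⟪A (Pi.single 0 1), Y⟫ = 0 ∧ ⟪A (Pi.single 3 1), Y⟫ = 0 ∧
        (A (Pi.single 2 1) ≠ 0 → ∃ c : ℝ, Y = c • A (Pi.single 2 1)) ∧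
        skyrmeSymbol A (s • (Pi.single 3 1 : Fin 4 → ℝ) + r • (Pi.single 0 1 : Fin 4 → ℝ)) Y Y
          = s ^ 2 * (1 - ‖A (Pi.single 0 1)‖ ^ 2)
            - r ^ 2 * (1 + ‖A (Pi.single 3 1)‖ ^ 2) ∧
        skyrmeSymbol A (s • (Pi.single 3 1 : Fin 4 → ℝ) + r • (Pi.single 0 1 : Fin 4 → ℝ)) Y Y < 0) ∧
    (∀ X : Fin 4 → ℝ, etaStar X < 0 →
      ∃ ξ : Fin 4 → ℝ, ξ ≠ 0 ∧ (∑ a, ξ a * X a) = 0 ∧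
        ¬ (∀ Y : E, Y ≠ 0 → 0 < skyrmeSymbol A ξ Y Y)) := by
  have hpart : ∀ s r : ℝ, (s, r) ≠ ((0 : ℝ), (0 : ℝ)) →
      ∃ Y : E, ‖Y‖ = 1 ∧ ⟪A (Pi.single 0 1), Y⟫ = 0 ∧ ⟪A (Pi.single 3 1), Y⟫ = 0 ∧
        (A (Pi.single 2 1) ≠ 0 → ∃ c : ℝ, Y = c • A (Pi.single 2 1)) ∧
        skyrmeSymbol A (s • (Pi.single 3 1 : Fin 4 → ℝ) + r • (Pi.single 0 1 : Fin 4 → ℝ)) Y Y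
          = s ^ 2 * (1 - ‖A (Pi.single 0 1)‖ ^ 2)
            - r ^ 2 * (1 + ‖A (Pi.single 3 1)‖ ^ 2) ∧
        skyrmeSymbol A (s • (Pi.single 3 1 : Fin 4 → ℝ) + r • (Pi.single 0 1 : Fin 4 → ℝ)) Y Y
          < 0 := by
    intro s r hsr
    obtain ⟨Y, hY, h0Y, h3Y, hpar, h2Y⟩ :=
      exists_unit_direction hdim.ge (hadapt 0 2 (by decide)) (hadapt 3 2 (by decide))
    have heq := skyrmeSymbol_eq_of_unit_direction A (hadapt 3 0 (by decide)) h1 hY h0Y h3Y h2Y s r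
    refine ⟨Y, hY, h0Y, h3Y, hpar, heq, ?_⟩
    rw [heq]
    have hl : 0 < ‖A (Pi.single 0 1)‖ ^ 2 - 1 := by nlinarith
    have hm : 0 < 1 + ‖A (Pi.single 3 1)‖ ^ 2 := by positivity
    by_cases hs : s = 0
    · have hr : r ≠ 0 := fun hr => hsr (by rw [hs, hr])
      have : 0 < r ^ 2 * (1 + ‖A (Pi.single 3 1)‖ ^ 2) := by positivity
      rw [hs]
      linarith
    · have h₁ : 0 < s ^ 2 * (‖A (Pi.single 0 1)‖ ^ 2 - 1) := by positivity
      have h₂ : 0 ≤ r ^ 2 * (1 + ‖A (Pi.single 3 1)‖ ^ 2) := by positivity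
      linarith
  refine ⟨hpart, fun X hX => ?_⟩
  have hX0 : X 0 ≠ 0 := by
    intro h
    simp [etaStar, eps, Fin.sum_univ_four, h] at hX
    nlinarith [mul_self_nonneg (X 1), mul_self_nonneg (X 2), mul_self_nonneg (X 3)]
  obtain ⟨Y, hY, -, -, -, -, hneg⟩ := hpart (X 0) (-X 3) (by simp [hX0])
  refine ⟨_, ?_, ?_, fun hpos => (hpos Y ?_).not_gt hneg⟩
  · intro h
    have := congrFun h 3
    simp [hX0] at this
  · simp [Fin.sum_univ_four]
    ring
  · rintro rfl
    simp at hY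
end

section
/- Let E be a 3-dimensional real inner product space and A : ℝ⁴ → E a linear map such that the standard basis is adapted to A, with Ae₃ = 0 and λ₁² < λ₀² − 1 < λ₂² (where λ_a = ‖Ae_a‖). Let P_A(ξ) denote the determinant of the matrix of the Skyrme principal symbol m_A(ξ) with respect to a fixed orthonormal basis of E, a homogeneous polynomial of degree 6 in ξ ∈ (ℝ⁴)*. Then P_A is not a hyperbolic polynomial in any direction: there is no covector η with P_A(η) ≠ 0 such that, for every covector ζ, all complex roots of the real polynomial s ↦ P_A(ζ + s·η) are real. (This is the paper's remark sharpening the Crutchfield–Bell instability: in this regime the linearized Skyrme system cannot be hyperbolic, so the Cauchy problem is ill-posed.) -/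
open RealInnerProductSpace

/-- The Minkowski quadratic form over an arbitrary commutative ring. -/
def minkowskiQuad {R : Type*} [CommRing R] (ξ : Fin 4 → R) : R :=
  -ξ 0 ^ 2 + ξ 1 ^ 2 + ξ 2 ^ 2 + ξ 3 ^ 2

/-- The quartic cofactor of `minkowskiQuad` in the determinant of the Skyrme symbol, viewed as a
quadratic polynomial in the value `q` of the Minkowski form; `L a = ‖A e_a‖²`. -/
def quarticAux {R : Type*} [CommRing R] (L : Fin 3 → R) (ξ : Fin 4 → R) (q : R) : R :=
  (1 + L 1 + L 2) * (1 - L 0 + L 2) * (1 - L 0 + L 1) * q ^ 2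
    - ((1 - L 0 + L 2) * (1 - L 0 + L 1) * (L 1 * ξ 1 ^ 2 + L 2 * ξ 2 ^ 2)
      + (1 + L 1 + L 2) * (1 - L 0 + L 1) * (L 0 * ξ 0 ^ 2 + L 2 * ξ 2 ^ 2)
      + (1 + L 1 + L 2) * (1 - L 0 + L 2) * (L 0 * ξ 0 ^ 2 + L 1 * ξ 1 ^ 2)) * q
    + (L 0 * ξ 0 ^ 2 + L 1 * ξ 1 ^ 2 + L 2 * ξ 2 ^ 2)
      * ((1 + L 1 + L 2) * (L 0 * ξ 0 ^ 2) + (1 - L 0 + L 2) * (L 1 * ξ 1 ^ 2)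
        + (1 - L 0 + L 1) * (L 2 * ξ 2 ^ 2))

/-- The characteristic polynomial of the Skyrme symbol in closed form. -/
def skyrmeChar {R : Type*} [CommRing R] (L : Fin 3 → R) (ξ : Fin 4 → R) : R :=
  minkowskiQuad ξ * quarticAux L ξ (minkowskiQuad ξ)

lemma map_skyrmeChar {R S : Type*} [CommRing R] [CommRing S] (f : R →+* S)
    (L : Fin 3 → R) (ξ : Fin 4 → R) :
    f (skyrmeChar L ξ) = skyrmeChar (fun a => f (L a)) (fun a => f (ξ a)) := by
  simp [skyrmeChar, quarticAux, minkowskiQuad]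

lemma OrthonormalBasis.det_inner_eq_det {E ι : Type*} [NormedAddCommGroup E]
    [InnerProductSpace ℝ E] [Fintype ι] [DecidableEq ι]
    (b : OrthonormalBasis ι ℝ E) (T : E →ₗ[ℝ] E) :
    (Matrix.of fun i j : ι => ⟪T (b i), b j⟫).det = LinearMap.det T := by
  rw [← LinearMap.det_toMatrix b.toBasis T, ← Matrix.det_transpose]
  congr 1
  ext i j
  simp [LinearMap.toMatrix_apply, OrthonormalBasis.repr_apply_apply, real_inner_comm]

lemma exists_skyrmeSymbol_eq_inner {E : Type*} [NormedAddCommGroup E] [InnerProductSpace ℝ E]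
    (A : (Fin 4 → ℝ) →ₗ[ℝ] E) (ξ : Fin 4 → ℝ) :
    ∃ T : E →ₗ[ℝ] E, ∀ Y Z, skyrmeSymbol A ξ Y Z = ⟪T Y, Z⟫ := by
  refine ⟨(etaStar ξ * (1 + ∑ a, eps a * ‖A (Pi.single a 1)‖ ^ 2) - ‖A (sharp ξ)‖ ^ 2)
      • LinearMap.id
    - ∑ a, (etaStar ξ * eps a) • (innerₛₗ ℝ (A (Pi.single a 1))).smulRight (A (Pi.single a 1))
    + (innerₛₗ ℝ (A (sharp ξ))).smulRight (A (sharp ξ)), fun Y Z => ?_⟩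
  simp only [skyrmeSymbol, LinearMap.add_apply, LinearMap.sub_apply, LinearMap.smul_apply,
    LinearMap.id_apply, LinearMap.smulRight_apply, innerₛₗ_apply_apply,
    inner_add_left, inner_sub_left, inner_smul_left, Fin.sum_univ_four]
  simp only [conj_trivial]
  ring

lemma exists_orthonormalBasis_eq_norm_smul {E ι : Type*} [NormedAddCommGroup E]
    [InnerProductSpace ℝ E] [FiniteDimensional ℝ E] [Fintype ι]
    (hdim : Module.finrank ℝ E = Fintype.card ι) (u : ι → E)
    (hu : ∀ i j, i ≠ j → ⟪u i, u j⟫ = 0) :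
    ∃ f : OrthonormalBasis ι ℝ E, ∀ i, u i = ‖u i‖ • f i := by
  have horth : Orthonormal ℝ ({i | u i ≠ 0}.domRestrict fun i => ‖u i‖⁻¹ • u i) := by
    refine ⟨fun i => ?_, fun i j hij => ?_⟩
    · simpa using norm_smul_inv_norm (𝕜 := ℝ) i.2
    · simp [inner_smul_left, inner_smul_right, hu i j (Subtype.coe_ne_coe.mpr hij)]
  obtain ⟨f, hf⟩ := horth.exists_orthonormalBasis_extension_of_card_eq hdim
  refine ⟨f, fun i => ?_⟩
  by_cases h : u i = 0
  · simp [h]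
  · rw [hf i h, smul_smul, mul_inv_cancel₀ (norm_ne_zero_iff.mpr h), one_smul]

lemma det_skyrmeSymbol {E : Type*} [NormedAddCommGroup E] [InnerProductSpace ℝ E]
    [FiniteDimensional ℝ E] (b : OrthonormalBasis (Fin 3) ℝ E)
    (A : (Fin 4 → ℝ) →ₗ[ℝ] E)
    (hadapt : ∀ a c : Fin 4, a ≠ c → ⟪A (Pi.single a 1), A (Pi.single c 1)⟫ = 0)
    (h3 : A (Pi.single 3 1) = 0) (ξ : Fin 4 → ℝ) :
    (Matrix.of fun i j : Fin 3 => skyrmeSymbol A ξ (b i) (b j)).det =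
      skyrmeChar (fun a : Fin 3 => ‖A (Pi.single a.castSucc 1)‖ ^ 2) ξ := by
  obtain ⟨f, hf⟩ := exists_orthonormalBasis_eq_norm_smul
    (Module.finrank_eq_card_basis b.toBasis) (fun a : Fin 3 => A (Pi.single a.castSucc 1))
    (fun i j hij => hadapt _ _ (by simpa using hij))
  have hdet : (Matrix.of fun i j : Fin 3 => skyrmeSymbol A ξ (b i) (b j)).det =
      (Matrix.of fun i j : Fin 3 => skyrmeSymbol A ξ (f i) (f j)).det := by
    obtain ⟨T, hT⟩ := exists_skyrmeSymbol_eq_inner A ξ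
    simp only [hT, OrthonormalBasis.det_inner_eq_det]
  rw [hdet]
  generalize hl : (fun a : Fin 3 => ‖A (Pi.single a.castSucc 1)‖) = l
  have hl' : ∀ a : Fin 3, ‖A (Pi.single a.castSucc 1)‖ = l a := fun a => congrFun hl a
  have h0 : A (Pi.single 0 1) = l 0 • f 0 := (hf 0).trans (by rw [hl'])
  have h1 : A (Pi.single 1 1) = l 1 • f 1 := (hf 1).trans (by rw [hl'])
  have h2 : A (Pi.single 2 1) = l 2 • f 2 := (hf 2).trans (by rw [hl'])
  have hinner : ∀ i j, ⟪f i, f j⟫ = if i = j then (1 : ℝ) else 0 :=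
    fun i j => orthonormal_iff_ite.mp f.orthonormal i j
  have hsharp : A (sharp ξ) = (-ξ 0 * l 0) • f 0 + (ξ 1 * l 1) • f 1 + (ξ 2 * l 2) • f 2 := by
    rw [LinearMap.pi_apply_eq_sum_univ A (sharp ξ)]
    have hs : ∀ a : Fin 4, (fun j => if a = j then (1 : ℝ) else 0) = Pi.single a 1 := by
      intro a
      ext j
      simp [Pi.single_apply, eq_comm]
    simp only [hs, Fin.sum_univ_four, h0, h1, h2, h3, sharp, eps]
    simp [smul_smul]
  have hsymb : ∀ i j, skyrmeSymbol A ξ (f i) (f j) =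
      minkowskiQuad ξ * ((1 - l 0 ^ 2 + l 1 ^ 2 + l 2 ^ 2) * ⟪f i, f j⟫
        - (-(l 0 * ⟪f 0, f i⟫ * (l 0 * ⟪f 0, f j⟫)) + l 1 * ⟪f 1, f i⟫ * (l 1 * ⟪f 1, f j⟫)
          + l 2 * ⟪f 2, f i⟫ * (l 2 * ⟪f 2, f j⟫)))
      + (-ξ 0 * l 0 * ⟪f 0, f i⟫ + ξ 1 * l 1 * ⟪f 1, f i⟫ + ξ 2 * l 2 * ⟪f 2, f i⟫)
        * (-ξ 0 * l 0 * ⟪f 0, f j⟫ + ξ 1 * l 1 * ⟪f 1, f j⟫ + ξ 2 * l 2 * ⟪f 2, f j⟫)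
      - (l 0 ^ 2 * ξ 0 ^ 2 + l 1 ^ 2 * ξ 1 ^ 2 + l 2 ^ 2 * ξ 2 ^ 2) * ⟪f i, f j⟫ := by
    intro i j
    have hn : ‖A (sharp ξ)‖ ^ 2 =
        l 0 ^ 2 * ξ 0 ^ 2 + l 1 ^ 2 * ξ 1 ^ 2 + l 2 ^ 2 * ξ 2 ^ 2 := by
      rw [← real_inner_self_eq_norm_sq, hsharp]
      simp only [inner_add_left, inner_add_right, inner_smul_left, inner_smul_right, hinner,
        conj_trivial]
      simp
      ring
    rw [skyrmeSymbol, hn, hsharp]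
    simp only [Fin.sum_univ_four, h0, h1, h2, h3, etaStar, eps, inner_add_left, inner_smul_left,
      conj_trivial, norm_smul, f.norm_eq_one, minkowskiQuad]
    simp
    ring
  simp only [hsymb, hinner]
  simp only [hl', Matrix.det_fin_three, Matrix.of_apply]
  simp [skyrmeChar, quarticAux]
  ring

/-- If the univariate restrictions of `skyrmeChar L` along `η` are real-rooted, its complexified
restrictions have no non-real zeros. -/
lemma im_eq_zero_of_skyrmeChar_eq_zero {L : Fin 3 → ℝ} {η : Fin 4 → ℝ}
    (h : ∀ ζ : Fin 4 → ℝ, ∀ p : Polynomial ℝ,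
      (∀ s : ℝ, p.eval s = skyrmeChar L (ζ + s • η)) →
      ∀ z : ℂ, (p.map (algebraMap ℝ ℂ)).IsRoot z → z.im = 0)
    (ζ : Fin 4 → ℝ) (z : ℂ)
    (hz : skyrmeChar (fun a => (L a : ℂ)) (fun a => (ζ a : ℂ) + z * (η a : ℂ)) = 0) :
    z.im = 0 := by
  refine h ζ (skyrmeChar (fun a => Polynomial.C (L a))
    (fun a => Polynomial.C (ζ a) + Polynomial.C (η a) * Polynomial.X)) (fun s => ?_) z ?_
  · rw [← Polynomial.coe_evalRingHom, map_skyrmeChar]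
    congr 1
    · simp
    · ext a
      simp [mul_comm s]
  · rw [Polynomial.IsRoot, Polynomial.eval_map, ← Polynomial.coe_eval₂RingHom, map_skyrmeChar]
    simpa [mul_comm z] using hz

lemma exists_ne_zero_orthogonal (η : Fin 4 → ℝ) :
    ∃ ζ : Fin 4 → ℝ, ζ 0 = 0 ∧ ζ 3 = 0 ∧ ζ 1 * η 1 + ζ 2 * η 2 = 0 ∧
      0 < ζ 1 ^ 2 + ζ 2 ^ 2 := by
  by_cases h : η 1 = 0
  · exact ⟨![0, 1, 0, 0], by simp [h]⟩
  · refine ⟨![0, -η 2, η 1, 0], by simp, by simp, by simp; ring, ?_⟩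
    have := sq_pos_of_ne_zero h
    simp
    positivity

/-- Along a spacelike direction the Minkowski factor has non-real zeros. -/
lemma exists_im_ne_zero_of_spacelike (L : Fin 3 → ℝ) {η : Fin 4 → ℝ}
    (hη : 0 < minkowskiQuad η) :
    ∃ (ζ : Fin 4 → ℝ) (z : ℂ), z.im ≠ 0 ∧
      skyrmeChar (fun a => (L a : ℂ)) (fun a => (ζ a : ℂ) + z * (η a : ℂ)) = 0 := by
  obtain ⟨ζ, h0, h3, h12, hpos⟩ := exists_ne_zero_orthogonal η
  have hr : 0 < (ζ 1 ^ 2 + ζ 2 ^ 2) / minkowskiQuad η := div_pos hpos hη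
  obtain ⟨r, hrpos, hrsq⟩ : ∃ r : ℝ, 0 < r ∧ r ^ 2 = (ζ 1 ^ 2 + ζ 2 ^ 2) / minkowskiQuad η :=
    ⟨_, Real.sqrt_pos.mpr hr, Real.sq_sqrt hr.le⟩
  have hr2 : r ^ 2 * minkowskiQuad η = ζ 1 ^ 2 + ζ 2 ^ 2 := by
    rw [hrsq, div_mul_cancel₀ _ hη.ne']
  refine ⟨ζ, Complex.I * r, by simpa using hrpos.ne', ?_⟩
  have hq : minkowskiQuad (fun a => (ζ a : ℂ) + Complex.I * r * (η a : ℂ)) = 0 := by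
    have h12' : (ζ 1 : ℂ) * η 1 + ζ 2 * η 2 = 0 := mod_cast h12
    have hr2' := congrArg (Complex.ofReal) hr2
    simp only [minkowskiQuad] at hr2' ⊢
    push_cast at hr2'
    simp only [h0, h3, Complex.ofReal_zero]
    linear_combination 2 * Complex.I * r * h12' - hr2' +
      (r ^ 2 * (-η 0 ^ 2 + η 1 ^ 2 + η 2 ^ 2 + η 3 ^ 2)) * Complex.I_sq
  rw [skyrmeChar, hq, zero_mul]

lemma quarticAux_planar_eq {R : Type*} [CommRing R] (L : Fin 3 → R) (ξ : Fin 4 → R) :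
    quarticAux L ξ (-ξ 0 ^ 2 + ξ 1 ^ 2 + ξ 2 ^ 2) =
      ((1 + L 1 + L 2) * ξ 0 ^ 2 - (1 - L 0 + L 2) * ξ 1 ^ 2 - (1 - L 0 + L 1) * ξ 2 ^ 2)
      * ((1 + L 1) * (1 + L 2) * ξ 0 ^ 2 + (L 0 - 1) * (1 + L 2) * ξ 1 ^ 2
        + (L 0 - 1) * (1 + L 1) * ξ 2 ^ 2) := by
  simp only [quarticAux]
  ring

lemma quarticAux_planar_pos {L : Fin 3 → ℝ} {η : Fin 4 → ℝ} (hL1 : 0 ≤ L 1)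
    (hlow : L 1 < L 0 - 1) (hhigh : L 0 - 1 < L 2) (hη : minkowskiQuad η < 0) :
    0 < quarticAux L η (-η 0 ^ 2 + η 1 ^ 2 + η 2 ^ 2) := by
  have hx : η 1 ^ 2 < η 0 ^ 2 := by
    simp only [minkowskiQuad] at hη
    nlinarith [sq_nonneg (η 2), sq_nonneg (η 3)]
  have hx0 : 0 < η 0 ^ 2 := lt_of_le_of_lt (sq_nonneg _) hx
  have hL0 : 0 < L 0 - 1 := by linarith
  have hL2 : 0 < L 2 := by linarith
  rw [quarticAux_planar_eq]
  apply mul_pos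
  · have hb : (1 - L 0 + L 2) * η 1 ^ 2 ≤ (1 - L 0 + L 2) * η 0 ^ 2 :=
      mul_le_mul_of_nonneg_left hx.le (by linarith)
    have hc : (1 - L 0 + L 1) * η 2 ^ 2 ≤ 0 :=
      mul_nonpos_of_nonpos_of_nonneg (by linarith) (sq_nonneg _)
    have ha : 0 < (L 0 + L 1) * η 0 ^ 2 := mul_pos (by linarith) hx0
    linarith
  · positivity

lemma exists_lt_root_of_neg_of_pos {k m n x₀ : ℝ} (hk : k < 0)
    (h : 0 < k * x₀ ^ 2 - m * x₀ + n) : ∃ x < x₀, k * x ^ 2 - m * x + n = 0 := by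
  have hdisc : (2 * k * x₀ - m) ^ 2 < m ^ 2 - 4 * k * n := by nlinarith
  have hd : 0 ≤ m ^ 2 - 4 * k * n := (sq_nonneg _).trans hdisc.le
  have hs := Real.sq_sqrt hd
  have hlt := Real.lt_sqrt_of_sq_lt hdisc
  have hk0 : k ≠ 0 := hk.ne
  generalize √(m ^ 2 - 4 * k * n) = d at hs hlt
  refine ⟨(m + d) / (2 * k), ?_, ?_⟩
  · rw [div_lt_iff_of_neg (by linarith)]
    linarith
  · field_simp
    linear_combination hs

/-- Along a timelike direction the quartic factor has non-real zeros. -/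
lemma exists_im_ne_zero_of_timelike {L : Fin 3 → ℝ} {η : Fin 4 → ℝ} (hL1 : 0 ≤ L 1)
    (hlow : L 1 < L 0 - 1) (hhigh : L 0 - 1 < L 2) (hη : minkowskiQuad η < 0) :
    ∃ (ζ : Fin 4 → ℝ) (z : ℂ), z.im ≠ 0 ∧
      skyrmeChar (fun a => (L a : ℂ)) (fun a => (ζ a : ℂ) + z * (η a : ℂ)) = 0 := by
  have hk : (1 + L 1 + L 2) * (1 - L 0 + L 2) * (1 - L 0 + L 1) < 0 :=
    mul_neg_of_pos_of_neg (mul_pos (by linarith) (by linarith)) (by linarith)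
  obtain ⟨q, hq, hroot⟩ :=
    exists_lt_root_of_neg_of_pos hk (quarticAux_planar_pos hL1 hlow hhigh hη)
  obtain ⟨r, hr, hr2⟩ : ∃ r : ℝ, 0 < r ∧ r ^ 2 = -η 0 ^ 2 + η 1 ^ 2 + η 2 ^ 2 - q :=
    ⟨_, Real.sqrt_pos.mpr (sub_pos.mpr hq), Real.sq_sqrt (sub_pos.mpr hq).le⟩
  have hden : (r : ℂ) - Complex.I * η 3 ≠ 0 := by
    intro h
    have := congrArg Complex.re h
    simp at this
    exact hr.ne' this
  obtain ⟨z, hz⟩ : ∃ z : ℂ, z * r = Complex.I * (1 + z * η 3) :=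
    ⟨Complex.I / (r - Complex.I * η 3), by field_simp; ring⟩
  refine ⟨Pi.single 3 1, z, fun him => ?_, ?_⟩
  · have hre := congrArg Complex.re hz
    have him' := congrArg Complex.im hz
    simp [him] at hre him'
    simp [hre.resolve_right hr.ne'] at him'
  · have hr2' := congrArg Complex.ofReal hr2
    have hrootC := congrArg Complex.ofReal hroot
    push_cast at hr2' hrootC
    have hquad : minkowskiQuad
        (fun a => ((Pi.single 3 1 : Fin 4 → ℝ) a : ℂ) + z * (η a : ℂ)) = q * z ^ 2 := by
      simp [minkowskiQuad]
      linear_combination (-z ^ 2) * hr2' + (z * r + Complex.I * (1 + z * η 3)) * hz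
        + (1 + z * η 3) ^ 2 * Complex.I_sq
    rw [skyrmeChar, hquad]
    simp [quarticAux]
    right
    linear_combination z ^ 4 * hrootC

/-- In the tachyonic regime `λ₁² < λ₀² − 1 < λ₂²` (with `Ae₃ = 0`, adapted basis,
`E` 3-dimensional with orthonormal basis `b`), the determinant polynomial
`P_A(ξ) = det (m_A(ξ)(b i, b j))` — a homogeneous degree-6 polynomial in `ξ` — is not
hyperbolic in any direction: there is no covector `η` with `P_A(η) ≠ 0` such that for
every `ζ` all complex roots of the real polynomial `s ↦ P_A(ζ + s·η)` are real. -/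
theorem stmt11 {E : Type*} [NormedAddCommGroup E] [InnerProductSpace ℝ E]
    [FiniteDimensional ℝ E] (b : OrthonormalBasis (Fin 3) ℝ E)
    (A : (Fin 4 → ℝ) →ₗ[ℝ] E)
    (hadapt : ∀ a c : Fin 4, a ≠ c → ⟪A (Pi.single a 1), A (Pi.single c 1)⟫ = 0)
    (h3 : A (Pi.single 3 1) = 0)
    (hlow : ‖A (Pi.single 1 1)‖ ^ 2 < ‖A (Pi.single 0 1)‖ ^ 2 - 1)
    (hhigh : ‖A (Pi.single 0 1)‖ ^ 2 - 1 < ‖A (Pi.single 2 1)‖ ^ 2) :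
    ¬ ∃ η : Fin 4 → ℝ,
      (Matrix.of fun i j : Fin 3 => skyrmeSymbol A η (b i) (b j)).det ≠ 0 ∧
      ∀ ζ : Fin 4 → ℝ, ∀ p : Polynomial ℝ,
        (∀ s : ℝ, p.eval s =
          (Matrix.of fun i j : Fin 3 =>
            skyrmeSymbol A (ζ + s • η) (b i) (b j)).det) →
        ∀ z : ℂ, (p.map (algebraMap ℝ ℂ)).IsRoot z → z.im = 0 := by
  rintro ⟨η, hne, hreal⟩
  simp only [det_skyrmeSymbol b A hadapt h3] at hne hreal
  have hroots := im_eq_zero_of_skyrmeChar_eq_zero hreal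
  rcases lt_trichotomy (minkowskiQuad η) 0 with hη | hη | hη
  · obtain ⟨ζ, z, hz, h⟩ := exists_im_ne_zero_of_timelike
      (L := fun a : Fin 3 => ‖A (Pi.single a.castSucc 1)‖ ^ 2) (sq_nonneg _) hlow hhigh hη
    exact hz (hroots ζ z h)
  · exact hne (by rw [skyrmeChar, hη, zero_mul])
  · obtain ⟨ζ, z, hz, h⟩ := exists_im_ne_zero_of_spacelike
      (fun a : Fin 3 => ‖A (Pi.single a.castSucc 1)‖ ^ 2) hη
    exact hz (hroots ζ z h)
end

section
/- There exists ε₀ > 0 such that for every ε with 0 < ε ≤ ε₀: (i) the matrix m⁰⁰ = m̃⁰⁰ − ε·I₂ = −(1+ε)I₂ is negative definite, and (ii) for every (ξ₁,ξ₂) ≠ (0,0) the matrix ξ₁²m̃¹¹ + 2ξ₁ξ₂m̃¹² + ξ₂²m̃²² − ε(ξ₁² + ξ₂²)·I₂ is positive definite. (Hence for sufficiently small ε the coefficients m^{ab}_{AB} = m̃^{ab}_{AB} − ε δ^{ab}δ_{AB} are regularly hyperbolic with time function t and observer field ∂_t.) -/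
/-- Sylvester's criterion for real symmetric `2 × 2` matrices. -/
theorem Matrix.posDef_fin_two_of_pos {a b c : ℝ} (ha : 0 < a) (hdet : b ^ 2 < a * c) :
    (!![a, b; b, c] : Matrix (Fin 2) (Fin 2) ℝ).PosDef := by
  refine Matrix.PosDef.of_dotProduct_mulVec_pos ?_ fun v hv => ?_
  · ext i j
    fin_cases i <;> fin_cases j <;> simp
  · have hform : star v ⬝ᵥ (!![a, b; b, c] : Matrix (Fin 2) (Fin 2) ℝ).mulVec v
        = ((a * v 0 + b * v 1) ^ 2 + (a * c - b ^ 2) * v 1 ^ 2) / a := by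
      simp [Matrix.mulVec, dotProduct, Fin.sum_univ_two]
      field_simp
      ring
    rw [hform]
    refine div_pos ?_ ha
    by_cases h1 : v 1 = 0
    · have h0 : v 0 ≠ 0 := fun h0 => hv (by ext i; fin_cases i <;> assumption)
      rw [h1]
      simp only [mul_zero, add_zero]
      positivity
    · have hd : 0 < a * c - b ^ 2 := sub_pos.mpr hdet
      positivity


/-- There is an `ε₀ > 0` such that for all `0 < ε ≤ ε₀`: (i) `m⁰⁰ = −(1+ε)I₂` is negative
definite, and (ii) for every `(ξ₁,ξ₂) ≠ (0,0)` the matrix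
`ξ₁²m̃¹¹ + 2ξ₁ξ₂m̃¹² + ξ₂²m̃²² − ε(ξ₁²+ξ₂²)I₂` is positive definite; hence the perturbed
coefficients `m^{ab}_{AB} = m̃^{ab}_{AB} − ε δ^{ab}δ_{AB}` are regularly hyperbolic. -/
theorem stmt13 :
    ∃ ε₀ > (0 : ℝ), ∀ ε : ℝ, 0 < ε → ε ≤ ε₀ →
      (-((-(1 + ε)) • (1 : Matrix (Fin 2) (Fin 2) ℝ))).PosDef ∧
      ∀ ξ₁ ξ₂ : ℝ, (ξ₁, ξ₂) ≠ ((0 : ℝ), (0 : ℝ)) →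
        (ξ₁ ^ 2 • (!![2, 1; 1, 1] : Matrix (Fin 2) (Fin 2) ℝ)
          + (2 * ξ₁ * ξ₂) • (!![1, 1; 1, 1] : Matrix (Fin 2) (Fin 2) ℝ)
          + ξ₂ ^ 2 • (!![1, 1; 1, 2] : Matrix (Fin 2) (Fin 2) ℝ)
          - (ε * (ξ₁ ^ 2 + ξ₂ ^ 2)) • (1 : Matrix (Fin 2) (Fin 2) ℝ)).PosDef := by
  refine ⟨1 / 10, by norm_num, fun ε hε hε₀ => ⟨?_, fun s t hst => ?_⟩⟩
  · rw [neg_smul, neg_neg]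
    exact Matrix.PosDef.one.smul (by positivity)
  · have hr : 0 < s ^ 2 + t ^ 2 := by
      by_contra! h
      exact hst (Prod.ext (by nlinarith [sq_nonneg s, sq_nonneg t])
        (by nlinarith [sq_nonneg s, sq_nonneg t]))
    have hεr : ε * (s ^ 2 + t ^ 2) ≤ 1 / 10 * (s ^ 2 + t ^ 2) := by gcongr
    convert Matrix.posDef_fin_two_of_pos (a := 2 * s ^ 2 + 2 * s * t + t ^ 2 - ε * (s ^ 2 + t ^ 2))
      (b := (s + t) ^ 2) (c := s ^ 2 + 2 * s * t + 2 * t ^ 2 - ε * (s ^ 2 + t ^ 2)) ?_ ?_ using 1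
    · ext i j
      fin_cases i <;> fin_cases j <;> simp <;> ring
    · nlinarith [sq_nonneg (3 * s + 2 * t)]
    · have htrace : ε * (s ^ 2 + t ^ 2) * (s ^ 2 + t ^ 2 + 2 * (s + t) ^ 2)
          ≤ 1 / 10 * (s ^ 2 + t ^ 2) * (s ^ 2 + t ^ 2 + 2 * (s + t) ^ 2) := by gcongr
      have hcross : 0 ≤ (s ^ 2 + t ^ 2) * (s + t) ^ 2 := by positivity
      nlinarith [sq_nonneg (ε * (s ^ 2 + t ^ 2)), sq_nonneg ((s + t) ^ 2), mul_pos hr hr]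
end

section
/- Let d, n ≥ 1, let m^{ab}_{AB} : ℝ^d → ℝ (a,b ∈ {1,…,d}, A,B ∈ {1,…,n}) be continuously differentiable coefficients symmetric in (a,b) and in (A,B), let ψ : ℝ^d → ℝⁿ be twice continuously differentiable, and let F : ℝ^d → ℝⁿ be such that Σ_{a,b,B} m^{ab}_{AB}(x) ∂²_{ab}ψ^B(x) = F_A(x) for all x and A. Define Z^{ab}_{AB}|^c_d := m^{ab}_{AB} δ^c_d − m^{cb}_{AB} δ^a_d − m^{ac}_{AB} δ^b_d and the canonical stress Q[ψ]^c_d := − Σ Z^{ab}_{AB}|^c_d ∂_aψ^A ∂_bψ^B. Then the divergence identity Σ_c ∂_c Q[ψ]^c_d = − Σ (∂_c Z^{ab}_{AB}|^c_d) ∂_aψ^A ∂_bψ^B + 2 Σ_B (∂_dψ^B) F_B holds at every point. In particular, the divergence of the canonical stress depends only on first derivatives of ψ. -/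
/-- The partial derivative `∂_a f` of a scalar function on `ℝ^d`. -/
noncomputable def pd {d : ℕ} (f : (Fin d → ℝ) → ℝ) (a : Fin d) (x : Fin d → ℝ) : ℝ :=
  fderiv ℝ f x (Pi.single a 1)

/-- The tensor `Z^{ab}_{AB}|^c_e := m^{ab}_{AB} δ^c_e − m^{cb}_{AB} δ^a_e − m^{ac}_{AB} δ^b_e`. -/
noncomputable def Zt {d n : ℕ} (m : Fin d → Fin d → Fin n → Fin n → (Fin d → ℝ) → ℝ)
    (a b : Fin d) (A B : Fin n) (c e : Fin d) (x : Fin d → ℝ) : ℝ :=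
  m a b A B x * (if c = e then 1 else 0)
    - m c b A B x * (if a = e then 1 else 0)
    - m a c A B x * (if b = e then 1 else 0)

/-- The canonical stress `Q[ψ]^c_e := − Z^{ab}_{AB}|^c_e ∂_aψ^A ∂_bψ^B` of
Christodoulou's regular hyperbolicity framework. -/
noncomputable def Qstress {d n : ℕ} (m : Fin d → Fin d → Fin n → Fin n → (Fin d → ℝ) → ℝ)
    (ψ : Fin n → (Fin d → ℝ) → ℝ) (c e : Fin d) (x : Fin d → ℝ) : ℝ :=
  - ∑ a, ∑ b, ∑ A, ∑ B, Zt m a b A B c e x * pd (ψ A) a x * pd (ψ B) b x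

lemma pd_neg {d : ℕ} (f : (Fin d → ℝ) → ℝ) (a : Fin d) (x : Fin d → ℝ) :
    pd (fun y => -f y) a x = -pd f a x := by
  simp [pd, fderiv_fun_neg]

lemma pd_sum {d : ℕ} {ι : Type*} (s : Finset ι) {f : ι → (Fin d → ℝ) → ℝ}
    (hf : ∀ i, Differentiable ℝ (f i)) (a : Fin d) (x : Fin d → ℝ) :
    pd (fun y => ∑ i ∈ s, f i y) a x = ∑ i ∈ s, pd (f i) a x := by
  simp [pd, fderiv_fun_sum fun i _ => hf i x]

lemma pd_mul {d : ℕ} {f g : (Fin d → ℝ) → ℝ} (hf : Differentiable ℝ f)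
    (hg : Differentiable ℝ g) (a : Fin d) (x : Fin d → ℝ) :
    pd (fun y => f y * g y) a x = pd f a x * g x + f x * pd g a x := by
  simp [pd, fderiv_fun_mul (hf x) (hg x)]
  ring

lemma differentiable_pd {d : ℕ} {f : (Fin d → ℝ) → ℝ} (hf : ContDiff ℝ 2 f) (a : Fin d) :
    Differentiable ℝ (pd f a) := by
  have h : Differentiable ℝ (fderiv ℝ f) :=
    (hf.fderiv_right (m := 1) (by norm_num)).differentiable (by norm_num)
  exact h.clm_apply (differentiable_const _)

lemma pd_pd_comm {d : ℕ} {f : (Fin d → ℝ) → ℝ} (hf : ContDiff ℝ 2 f) (a b : Fin d)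
    (x : Fin d → ℝ) : pd (pd f a) b x = pd (pd f b) a x := by
  have h : Differentiable ℝ (fderiv ℝ f) :=
    (hf.fderiv_right (m := 1) (by norm_num)).differentiable (by norm_num)
  have key (a b : Fin d) :
      pd (pd f a) b x = fderiv ℝ (fderiv ℝ f) x (Pi.single b 1) (Pi.single a 1) := by
    unfold pd
    rw [fderiv_clm_apply (h x) (differentiableAt_const _)]
    simp
  rw [key, key]
  exact (hf.contDiffAt.isSymmSndFDerivAt (by simp)) _ _

lemma differentiable_Zt {d n : ℕ} {m : Fin d → Fin d → Fin n → Fin n → (Fin d → ℝ) → ℝ}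
    (hm : ∀ a b A B, Differentiable ℝ (m a b A B)) (a b : Fin d) (A B : Fin n) (c e : Fin d) :
    Differentiable ℝ (Zt m a b A B c e) :=
  (((hm a b A B).mul_const _).sub ((hm c b A B).mul_const _)).sub ((hm a c A B).mul_const _)

/-- The Leibniz rule for the divergence of the canonical stress. -/
lemma pd_Qstress {d n : ℕ} {m : Fin d → Fin d → Fin n → Fin n → (Fin d → ℝ) → ℝ}
    (hm : ∀ a b A B, Differentiable ℝ (m a b A B))
    {ψ : Fin n → (Fin d → ℝ) → ℝ} (hψ : ∀ A, ContDiff ℝ 2 (ψ A)) (c e : Fin d)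
    (x : Fin d → ℝ) :
    pd (fun y => Qstress m ψ c e y) c x =
      -(∑ a, ∑ b, ∑ A, ∑ B,
          pd (fun y => Zt m a b A B c e y) c x * pd (ψ A) a x * pd (ψ B) b x)
        - ∑ a, ∑ b, ∑ A, ∑ B, Zt m a b A B c e x *
          (pd (pd (ψ A) a) c x * pd (ψ B) b x + pd (ψ A) a x * pd (pd (ψ B) b) c x) := by
  have hp (A : Fin n) (a : Fin d) := differentiable_pd (hψ A) a
  have hZ := differentiable_Zt hm
  have h1 (a b : Fin d) (A B : Fin n) :
      Differentiable ℝ fun y => Zt m a b A B c e y * pd (ψ A) a y :=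
    (hZ a b A B c e).mul (hp A a)
  have h2 (a b : Fin d) (A B : Fin n) :
      Differentiable ℝ fun y => Zt m a b A B c e y * pd (ψ A) a y * pd (ψ B) b y :=
    (h1 a b A B).mul (hp B b)
  have h3 (a b : Fin d) (A : Fin n) := Differentiable.fun_sum fun B (_ : B ∈ Finset.univ) =>
    h2 a b A B
  have h4 (a b : Fin d) := Differentiable.fun_sum fun A (_ : A ∈ Finset.univ) => h3 a b A
  have h5 (a : Fin d) := Differentiable.fun_sum fun b (_ : b ∈ Finset.univ) => h4 a b
  unfold Qstress
  rw [pd_neg, pd_sum _ h5, ← neg_add', neg_inj, ← Finset.sum_add_distrib]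
  refine Finset.sum_congr rfl fun a _ => ?_
  rw [pd_sum _ (h4 a), ← Finset.sum_add_distrib]
  refine Finset.sum_congr rfl fun b _ => ?_
  rw [pd_sum _ (h3 a b), ← Finset.sum_add_distrib]
  refine Finset.sum_congr rfl fun A _ => ?_
  rw [pd_sum _ (h2 a b A), ← Finset.sum_add_distrib]
  refine Finset.sum_congr rfl fun B _ => ?_
  rw [pd_mul (h1 a b A B) (hp B b), pd_mul (hZ a b A B c e) (hp A a)]
  ring

/-- Contracting `Z` with the derivative of `p ⊗ p`, where `H A a c` stands for `∂_c p_a^A`,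
leaves only the principal part `m^{ab}_{AB} H^A_{ba}`. -/
lemma sum_Zt_mul {d n : ℕ} {m : Fin d → Fin d → Fin n → Fin n → (Fin d → ℝ) → ℝ}
    (hm1 : ∀ a b A B, m a b A B = m b a A B) (hm2 : ∀ a b A B, m a b A B = m a b B A)
    (p : Fin n → Fin d → ℝ) (H : Fin n → Fin d → Fin d → ℝ)
    (hH : ∀ A a b, H A a b = H A b a) (e : Fin d) (x : Fin d → ℝ) :
    ∑ c, ∑ a, ∑ b, ∑ A, ∑ B, Zt m a b A B c e x * (H A a c * p B b + p A a * H B b c) =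
      -(2 * ∑ B, p B e * ∑ a, ∑ b, ∑ A, m a b B A x * H A b a) := by
  let L (i j a b c : Fin d) : ℝ := ∑ A, ∑ B, m i j A B x * (H A a c * p B b)
  have hLsymm (i j a b c : Fin d) : L i j a b c = L j i a b c := by
    simp only [L, hm1 i j]
  have hLcomm (i j a b c : Fin d) : L i j a b c = L i j c b a := by
    simp only [L, hH _ a c]
  have hLswap (i j a b c : Fin d) :
      ∑ A, ∑ B, m i j A B x * (p A a * H B b c) = L i j b a c := by
    rw [Finset.sum_comm]
    refine Finset.sum_congr rfl fun A _ => Finset.sum_congr rfl fun B _ => ?_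
    rw [hm2 i j B A]
    ring
  have hK (a b c : Fin d) :
      ∑ A, ∑ B, Zt m a b A B c e x * (H A a c * p B b + p A a * H B b c) =
        (if c = e then L a b a b c + L a b b a c else 0)
          - (if a = e then L c b a b c + L c b b a c else 0)
          - (if b = e then L a c a b c + L a c b a c else 0) := by
    simp only [← hLswap _ _ a b, L, Zt, ← Finset.sum_add_distrib]
    split_ifs <;>
      simp only [← Finset.sum_sub_distrib, sub_zero, zero_sub, ← Finset.sum_neg_distrib,
        mul_one, mul_zero, zero_mul, Finset.sum_const_zero] <;>
      refine Finset.sum_congr rfl fun A _ => Finset.sum_congr rfl fun B _ => ?_ <;>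
      ring
  have hS1 : ∑ c, ∑ a, ∑ b, (if c = e then L a b a b c + L a b b a c else 0) =
      2 * ∑ a, ∑ b, L a b a b e := by
    have hswap : ∑ a, ∑ b, L a b b a e = ∑ a, ∑ b, L a b a b e := by
      rw [Finset.sum_comm]
      exact Finset.sum_congr rfl fun a _ => Finset.sum_congr rfl fun b _ => hLsymm _ _ _ _ _
    rw [Finset.sum_eq_single e (fun c _ hc => by simp [hc]) (by simp)]
    simp only [if_true, Finset.sum_add_distrib, hswap]
    ring
  have hS2 : ∑ c, ∑ a, ∑ b, (if a = e then L c b a b c + L c b b a c else 0) =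
      ∑ c, ∑ b, (L c b c b e + L c b b e c) := by
    refine Finset.sum_congr rfl fun c _ => ?_
    rw [Finset.sum_eq_single e (fun a _ ha => by simp [ha]) (by simp)]
    simp only [if_true, hLcomm _ _ e _ c]
  have hS3 : ∑ c, ∑ a, ∑ b, (if b = e then L a c a b c + L a c b a c else 0) =
      ∑ c, ∑ b, (L c b c b e + L c b b e c) := by
    refine Finset.sum_congr rfl fun c _ => Finset.sum_congr rfl fun a _ => ?_
    rw [Finset.sum_ite_eq' Finset.univ e, if_pos (Finset.mem_univ e), hLsymm a c a,
      hLsymm a c e, hLcomm c a e, add_comm]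
  have hR : ∑ B, p B e * ∑ a, ∑ b, ∑ A, m a b B A x * H A b a = ∑ a, ∑ b, L a b b e a := by
    simp only [← hLswap, Finset.mul_sum]
    rw [Finset.sum_comm]
    refine Finset.sum_congr rfl fun a _ => ?_
    rw [Finset.sum_comm]
    refine Finset.sum_congr rfl fun b _ => Finset.sum_congr rfl fun A _ =>
      Finset.sum_congr rfl fun B _ => ?_
    ring
  simp only [hK, Finset.sum_sub_distrib, hS1, hS2, hS3, hR, Finset.sum_add_distrib]
  ring

/-- Divergence identity for the canonical stress: if `ψ` solves
`m^{ab}_{AB} ∂²_{ab}ψ^B = F_A` with `m` symmetric in `(a,b)` and `(A,B)`, then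
`∂_c Q[ψ]^c_e = −(∂_c Z^{ab}_{AB}|^c_e) ∂_aψ^A ∂_bψ^B + 2(∂_eψ^B) F_B` at every point;
in particular the divergence of the canonical stress depends only on first
derivatives of `ψ`. -/
theorem stmt15 (d n : ℕ) (hd : 1 ≤ d) (hn : 1 ≤ n)
    (m : Fin d → Fin d → Fin n → Fin n → (Fin d → ℝ) → ℝ)
    (hm : ∀ a b A B, ContDiff ℝ 1 (m a b A B))
    (hmsymm1 : ∀ a b A B, m a b A B = m b a A B)
    (hmsymm2 : ∀ a b A B, m a b A B = m a b B A)
    (ψ : Fin n → (Fin d → ℝ) → ℝ) (hψ : ∀ A, ContDiff ℝ 2 (ψ A))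
    (F : Fin n → (Fin d → ℝ) → ℝ)
    (heq : ∀ (x : Fin d → ℝ) (A : Fin n),
      ∑ a, ∑ b, ∑ B, m a b A B x * pd (pd (ψ B) b) a x = F A x) :
    ∀ (e : Fin d) (x : Fin d → ℝ),
      ∑ c, pd (fun y => Qstress m ψ c e y) c x =
        - (∑ a, ∑ b, ∑ A, ∑ B, ∑ c,
            pd (fun y => Zt m a b A B c e y) c x * pd (ψ A) a x * pd (ψ B) b x)
          + 2 * ∑ B, pd (ψ B) e x * F B x := by
  intro e x
  have hm' (a b : Fin d) (A B : Fin n) : Differentiable ℝ (m a b A B) :=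
    (hm a b A B).differentiable (by norm_num)
  have hsum := sum_Zt_mul hmsymm1 hmsymm2 (fun A a => pd (ψ A) a x)
    (fun A a c => pd (pd (ψ A) a) c x) (fun A a b => pd_pd_comm (hψ A) a b x) e x
  simp only [heq] at hsum
  simp only [pd_Qstress hm' hψ, Finset.sum_sub_distrib, Finset.sum_neg_distrib, hsum,
    sub_neg_eq_add]
  congr 2
  rw [Finset.sum_comm]
  refine Finset.sum_congr rfl fun a _ => ?_
  rw [Finset.sum_comm]
  refine Finset.sum_congr rfl fun b _ => ?_
  rw [Finset.sum_comm]
  refine Finset.sum_congr rfl fun A _ => Finset.sum_comm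
end
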